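/- arXiv:math/0511373 — 2 statements merged into one kernel-verified Lean document; each statement's English description precedes it below -/
import Mathlib

section
/- Let n ≥ 1, let A ⊆ ℕⁿ be finite and nonempty, let I = (X^A) ⊆ ℂ[X₁,…,Xₙ], let r ≥ 1, and let b ∈ ℕⁿ. Then X^b is integral over the power I^r — i.e. there exist s ≥ 1 and polynomials g₁,…,g_s with gᵢ ∈ (I^r)ⁱ and (X^b)^s + g₁(X^b)^{s−1} + ⋯ + g_s = 0 — if and only if b, viewed as a point of ℝⁿ, lies in the dilated Newton polyhedron r • Γ⁺(A). (The integral closure of (z^A)^r is generated by the monomials z^a with a ∈ rΓ⁺(A).) -/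
open Pointwise MvPolynomial

/-- The Newton polyhedron `Γ⁺(A) = convexHull(A) + ℝ≥0ⁿ` of a finite `A ⊆ ℕⁿ`. -/
noncomputable def newtonPolyhedron (n : ℕ) (A : Finset (Fin n →₀ ℕ)) : Set (Fin n → ℝ) :=
  convexHull ℝ ((fun a : Fin n →₀ ℕ => fun i : Fin n => (a i : ℝ)) '' (A : Set (Fin n →₀ ℕ))) +
    {r : Fin n → ℝ | ∀ i, 0 ≤ r i}

/-- The exponent `a ∈ ℕⁿ` viewed as a point of `ℝⁿ`. -/
def realPoint {n : ℕ} (a : Fin n →₀ ℕ) : Fin n → ℝ := fun i => (a i : ℝ)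

theorem realPoint_injective (n : ℕ) : Function.Injective (realPoint (n := n)) := by
  intro a b h
  ext i
  exact Nat.cast_injective (R := ℝ) (congrFun h i)

/-- `b` dominates `t` times a point of the convex hull of `A`; unlike `t • Γ⁺(A)`, this is the
whole orthant for `t = 0`. -/
def DominatesHull {n : ℕ} (A : Finset (Fin n →₀ ℕ)) (t : ℝ) (b : Fin n → ℝ) : Prop :=
  ∃ y ∈ convexHull ℝ (realPoint '' (A : Set (Fin n →₀ ℕ))), t • y ≤ b

theorem DominatesHull.add {n : ℕ} {A : Finset (Fin n →₀ ℕ)} {s t : ℝ} {b c : Fin n → ℝ}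
    (hs : 0 ≤ s) (ht : 0 ≤ t) (hb : DominatesHull A s b) (hc : DominatesHull A t c) :
    DominatesHull A (s + t) (b + c) := by
  obtain ⟨y, hy, hyb⟩ := hb
  obtain ⟨z, hz, hzc⟩ := hc
  have h : s • y + t • z ∈ (s + t) • convexHull ℝ (realPoint '' (A : Set (Fin n →₀ ℕ))) := by
    rw [(convex_convexHull ℝ _).add_smul hs ht]
    exact Set.add_mem_add (Set.smul_mem_smul_set hy) (Set.smul_mem_smul_set hz)
  obtain ⟨w, hw, hwe⟩ := h
  refine ⟨w, hw, ?_⟩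
  have hwe' : (s + t) • w = s • y + t • z := hwe
  rw [hwe']
  exact add_le_add hyb hzc

theorem mem_smul_newtonPolyhedron_iff {n : ℕ} {A : Finset (Fin n →₀ ℕ)} {t : ℝ} (ht : 0 < t)
    {b : Fin n → ℝ} :
    b ∈ (fun x : Fin n → ℝ => t • x) '' newtonPolyhedron n A ↔ DominatesHull A t b := by
  constructor
  · rintro ⟨_, ⟨y, hy, z, hz, rfl⟩, rfl⟩
    refine ⟨y, hy, fun i => ?_⟩
    have := mul_nonneg ht.le (hz i)
    simp only [Pi.smul_apply, Pi.add_apply, smul_eq_mul]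
    linarith
  · rintro ⟨y, hy, hyb⟩
    refine ⟨y + t⁻¹ • (b - t • y), ⟨y, hy, _, fun i => ?_, rfl⟩, ?_⟩
    · have := hyb i
      simp only [Pi.smul_apply, Pi.sub_apply, smul_eq_mul] at this ⊢
      have := sub_nonneg.2 this
      positivity
    · ext i
      simp only [Pi.smul_apply, Pi.sub_apply, Pi.add_apply, smul_eq_mul]
      field_simp
      ring

/-- The exponents of the elements of `(X^A)^N` dominate `N` times the convex hull of `A`. -/
theorem dominatesHull_of_mem_pow {n : ℕ} {A : Finset (Fin n →₀ ℕ)} (hA : A.Nonempty) (N : ℕ) :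
    ∀ p ∈ (Ideal.span ((fun a : Fin n →₀ ℕ => (monomial a (1 : ℂ))) ''
      (A : Set (Fin n →₀ ℕ)))) ^ N, ∀ m ∈ p.support, DominatesHull A N (realPoint m) := by
  induction N with
  | zero =>
    intro p _ m _
    obtain ⟨a, ha⟩ := hA
    refine ⟨realPoint a, subset_convexHull ℝ _ ⟨a, ha, rfl⟩, fun i => ?_⟩
    simp [realPoint]
  | succ N ih =>
    intro p hp
    rw [pow_succ] at hp
    induction hp using Submodule.mul_induction_on' with
    | mem_mul_mem q hq l hl =>
      intro m hm
      obtain ⟨u, hu, v, hv, rfl⟩ := Finset.mem_add.1 (support_mul q l hm)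
      obtain ⟨a, ha, hav⟩ := mem_ideal_span_monomial_image.1 hl v hv
      have h1 : DominatesHull A 1 (realPoint v) := by
        refine ⟨realPoint a, subset_convexHull ℝ _ ⟨a, ha, rfl⟩, fun i => ?_⟩
        simpa [realPoint] using hav i
      have h := (ih q hq u hu).add N.cast_nonneg zero_le_one h1
      have e : realPoint (u + v) = realPoint u + realPoint v := by
        ext i; simp [realPoint]
      rw [e]
      exact_mod_cast h
    | add x _ y _ hx hy =>
      intro m hm
      rcases Finset.mem_union.1 (support_add hm) with h | h
      · exact hx m h
      · exact hy m h

theorem monomial_mem_span_pow {n : ℕ} {A : Finset (Fin n →₀ ℕ)} (k : (Fin n →₀ ℕ) → ℕ) {N : ℕ}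
    (hN : N ≤ ∑ a ∈ A, k a) {c : Fin n →₀ ℕ} (hc : ∑ a ∈ A, k a • a ≤ c) :
    monomial c (1 : ℂ) ∈ (Ideal.span ((fun a : Fin n →₀ ℕ => (monomial a (1 : ℂ))) ''
      (A : Set (Fin n →₀ ℕ)))) ^ N := by
  refine Ideal.pow_le_pow_right hN ?_
  rw [← Finset.prod_pow_eq_pow_sum]
  have h := Ideal.prod_mem_prod (s := A) (x := fun a => (monomial a (1 : ℂ)) ^ k a)
    (I := fun a => (Ideal.span ((fun a : Fin n →₀ ℕ => (monomial a (1 : ℂ))) ''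
      (A : Set (Fin n →₀ ℕ)))) ^ k a)
    fun a ha => Ideal.pow_mem_pow (Ideal.subset_span (Set.mem_image_of_mem _ ha)) _
  obtain ⟨d, rfl⟩ := exists_add_of_le hc
  have e : monomial (∑ a ∈ A, k a • a + d) (1 : ℂ)
      = (∏ a ∈ A, (monomial a (1 : ℂ)) ^ k a) * monomial d 1 := by
    simp only [monomial_pow, one_pow, ← monomial_sum_one, monomial_mul, one_mul]
  rw [e]
  exact Ideal.mul_mem_right _ _ h

/-- If `b` dominates `r` times the convex hull of `A`, then some positive multiple `s • b` dominates
a sum of `r * s` elements of `A`. -/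
theorem DominatesHull.exists_nat_combination {n : ℕ} {A : Finset (Fin n →₀ ℕ)} {r : ℕ}
    {b : Fin n →₀ ℕ} (h : DominatesHull A r (realPoint b)) :
    ∃ s : ℕ, 1 ≤ s ∧ ∃ k : (Fin n →₀ ℕ) → ℕ,
      r * s ≤ ∑ a ∈ A, k a ∧ ∑ a ∈ A, k a • a ≤ s • b := by
  classical
  obtain ⟨y, hy, hyb⟩ := h
  rw [← Finset.coe_image, Finset.mem_convexHull'] at hy
  obtain ⟨w, hw0, hw1, hwy⟩ := hy
  rw [Finset.sum_image (realPoint_injective n).injOn] at hw1 hwy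
  replace hw0 : ∀ a ∈ A, 0 ≤ w (realPoint a) := fun a ha =>
    hw0 _ (Finset.mem_image_of_mem _ ha)
  set k : ℕ → (Fin n →₀ ℕ) → ℕ := fun N a => ⌊(N * r : ℝ) * w (realPoint a)⌋₊ with hk
  have hk0 : ∀ N : ℕ, ∀ a ∈ A, (0 : ℝ) ≤ (N * r : ℝ) * w (realPoint a) := fun N a ha =>
    mul_nonneg (mul_nonneg N.cast_nonneg r.cast_nonneg) (hw0 a ha)
  have hkb : ∀ N i, ∑ a ∈ A, k N a * a i ≤ N * b i := by
    intro N i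
    have h1 : (∑ a ∈ A, (k N a : ℝ) * a i) ≤ N * (r * y i) := by
      rw [← hwy, Finset.sum_apply, Finset.mul_sum, Finset.mul_sum]
      refine Finset.sum_le_sum fun a ha => ?_
      have := mul_le_mul_of_nonneg_right (Nat.floor_le (hk0 N a ha)) (Nat.cast_nonneg (α := ℝ) (a i))
      simp only [Pi.smul_apply, smul_eq_mul, realPoint] at this ⊢
      convert this using 1
      ring
    have h2 : (N : ℝ) * (r * y i) ≤ N * b i :=
      mul_le_mul_of_nonneg_left (hyb i) N.cast_nonneg
    exact_mod_cast h1.trans h2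
  have hkr : ∀ N, N * r ≤ ∑ a ∈ A, k N a + A.card := by
    intro N
    have : (N * r : ℝ) ≤ ∑ a ∈ A, ((k N a : ℝ) + 1) := by
      calc (N * r : ℝ) = ∑ a ∈ A, (N * r : ℝ) * w (realPoint a) := by
            rw [← Finset.mul_sum, hw1, mul_one]
        _ ≤ _ := Finset.sum_le_sum fun a _ => (Nat.lt_floor_add_one _).le
    rw [Finset.sum_add_distrib, Finset.sum_const, nsmul_one] at this
    exact_mod_cast this
  have hmono : ∀ {M N}, M ≤ N → ∀ a ∈ A, k M a ≤ k N a := fun hMN a ha =>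
    Nat.floor_mono (mul_le_mul_of_nonneg_right
      (mul_le_mul_of_nonneg_right (Nat.cast_le.2 hMN) r.cast_nonneg) (hw0 a ha))
  -- Dickson's lemma gives `M < N` with both the remainders and the excesses nondecreasing.
  obtain ⟨M, N, hMN, hle⟩ := (wellQuasiOrderedLE_def _).1
    (inferInstance : WellQuasiOrderedLE ((Fin n → ℕ) × ℕ))
    fun N => (fun i => N * b i - ∑ a ∈ A, k N a * a i, ∑ a ∈ A, k N a + A.card - N * r)
  obtain ⟨hle1, hle2⟩ := Prod.mk_le_mk.1 hle
  have hsum : ∑ a ∈ A, (k N a - k M a) + ∑ a ∈ A, k M a = ∑ a ∈ A, k N a := by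
    rw [← Finset.sum_add_distrib]
    exact Finset.sum_congr rfl fun a ha => Nat.sub_add_cancel (hmono hMN.le a ha)
  have hsum' : ∀ i, ∑ a ∈ A, (k N a - k M a) * a i + ∑ a ∈ A, k M a * a i
      = ∑ a ∈ A, k N a * a i := by
    intro i
    rw [← Finset.sum_add_distrib]
    refine Finset.sum_congr rfl fun a ha => ?_
    rw [← add_mul, Nat.sub_add_cancel (hmono hMN.le a ha)]
  obtain ⟨s, rfl⟩ := exists_add_of_le hMN.le
  refine ⟨s, by omega, fun a => k (M + s) a - k M a, ?_, fun i => ?_⟩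
  · have h1 := hkr M
    have h2 := hkr (M + s)
    rw [add_mul] at h2 hle2
    rw [mul_comm]
    dsimp only
    omega
  · have h1 := hkb M i
    have h2 := hkb (M + s) i
    have h3 := hle1 i
    have h4 := hsum' i
    simp only [add_mul] at h2 h3
    simp only [Finsupp.coe_finsetSum, Finset.sum_apply, Finsupp.smul_apply, smul_eq_mul]
    omega

/-- `X^b` is integral over `I^r`, where `I = (X^A)`, iff `b` lies in the
dilated Newton polyhedron `r • Γ⁺(A)`. -/
theorem stmt7 (n : ℕ) (hn : 1 ≤ n) (A : Finset (Fin n →₀ ℕ)) (hA : A.Nonempty)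
    (r : ℕ) (hr : 1 ≤ r) (b : Fin n →₀ ℕ) :
    (∃ s : ℕ, 1 ≤ s ∧ ∃ g : ℕ → MvPolynomial (Fin n) ℂ,
        (∀ i ∈ Finset.Icc 1 s,
          g i ∈ ((Ideal.span ((fun a : Fin n →₀ ℕ => (monomial a (1 : ℂ))) ''
            (A : Set (Fin n →₀ ℕ)))) ^ r) ^ i) ∧
        (monomial b (1 : ℂ)) ^ s +
          ∑ i ∈ Finset.Icc 1 s, g i * (monomial b (1 : ℂ)) ^ (s - i) = 0) ↔
      (fun i : Fin n => (b i : ℝ)) ∈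
        (fun x : Fin n → ℝ => (r : ℝ) • x) '' newtonPolyhedron n A := by
  have hr0 : (0 : ℝ) < r := by exact_mod_cast hr
  rw [mem_smul_newtonPolyhedron_iff hr0]
  constructor
  · rintro ⟨s, hs, g, hg, h⟩
    have hc := congrArg (coeff (s • b)) h
    simp only [monomial_pow, one_pow, coeff_add, coeff_monomial, if_true, coeff_sum, coeff_zero]
      at hc
    obtain ⟨i, hi, hne⟩ : ∃ i ∈ Finset.Icc 1 s,
        coeff (s • b) (g i * monomial ((s - i) • b) (1 : ℂ)) ≠ 0 := by
      by_contra! h0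
      rw [Finset.sum_eq_zero h0] at hc
      simp at hc
    obtain ⟨hi1, his⟩ := Finset.mem_Icc.1 hi
    have e : s • b = i • b + (s - i) • b := by rw [← add_smul, Nat.add_sub_cancel' his]
    rw [e, coeff_mul_monomial, mul_one] at hne
    have hmem := hg i hi
    rw [← pow_mul] at hmem
    obtain ⟨y, hy, hyb⟩ := dominatesHull_of_mem_pow hA _ _ hmem _ (mem_support_iff.2 hne)
    refine ⟨y, hy, fun j => ?_⟩
    have hj := hyb j
    have hi0 : (0 : ℝ) < i := by exact_mod_cast hi1
    simp only [realPoint, Pi.smul_apply, Finsupp.smul_apply, smul_eq_mul, Nat.cast_mul] at hj ⊢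
    refine le_of_mul_le_mul_left ?_ hi0
    linarith
  · intro h
    obtain ⟨s, hs, k, hk, hkb⟩ := DominatesHull.exists_nat_combination h
    refine ⟨s, hs, fun i => if i = s then -(monomial b (1 : ℂ)) ^ s else 0, fun i _ => ?_, ?_⟩
    · dsimp only
      split_ifs with his
      · subst his
        rw [← pow_mul, monomial_pow, one_pow]
        exact neg_mem (monomial_mem_span_pow k hk hkb)
      · exact zero_mem _
    · rw [Finset.sum_eq_single s (fun i _ his => by simp [his])
        (fun h' => absurd (Finset.mem_Icc.2 ⟨hs, le_rfl⟩) h')]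
      simp
end

section
/- Let n ≥ 1 and let A, A' ⊆ ℕⁿ be finite sets, each with variety {0}. Define the Newton diagram Γ(A) = {x ∈ Γ⁺(A) : there exists ρ ∈ ℝⁿ with ρᵢ > 0 for all i and ρ·x ≤ ρ·y for all y ∈ Γ⁺(A)} (the union of the compact faces of Γ⁺(A)), and similarly Γ(A'). If A ∩ Γ(A) = A' ∩ Γ(A'), then a set B ⊆ ℕⁿ is an essential subset of A if and only if it is an essential subset of A'; consequently the ideals ⋂_{B essential for A} (X₁^{α₁^B},…,Xₙ^{αₙ^B}) and ⋂_{B essential for A'} (X₁^{α₁^B},…,Xₙ^{αₙ^B}) of ℂ[X₁,…,Xₙ] coincide. -/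
open Pointwise MvPolynomial

/-- `A ⊆ ℕⁿ` has variety `{0}`: `0 ∉ A` and `A` meets every coordinate axis. -/
def hasVarietyZero (n : ℕ) (A : Finset (Fin n →₀ ℕ)) : Prop :=
  (0 : Fin n →₀ ℕ) ∉ A ∧ ∀ i : Fin n, ∃ k : ℕ, 1 ≤ k ∧ Finsupp.single i k ∈ A

/-- The Newton diagram `Γ(A)`: the union of the compact faces of `Γ⁺(A)`, i.e. the points
of `Γ⁺(A)` supported by some linear functional with strictly positive coefficients. -/
noncomputable def newtonDiagram (n : ℕ) (A : Finset (Fin n →₀ ℕ)) : Set (Fin n → ℝ) :=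
  {x ∈ newtonPolyhedron n A | ∃ ρ : Fin n → ℝ, (∀ i, 0 < ρ i) ∧
    ∀ y ∈ newtonPolyhedron n A, ∑ i, ρ i * x i ≤ ∑ i, ρ i * y i}

/-- `B` is an essential subset of `A`. -/
def essential (n : ℕ) (A B : Finset (Fin n →₀ ℕ)) : Prop :=
  B ⊆ A ∧ B.card = n ∧
    LinearIndependent ℝ (fun b : B => fun i : Fin n => ((b : Fin n →₀ ℕ) i : ℝ)) ∧
    ∃ ρ : Fin n → ℝ, (∀ i, 0 ≤ ρ i) ∧ ρ ≠ 0 ∧ ∃ c : ℝ,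
      (∀ b ∈ B, ∑ i, ρ i * (b i : ℝ) = c) ∧ ∀ a ∈ A, c ≤ ∑ i, ρ i * (a i : ℝ)

/-- A nonnegative functional bounded below on `A` has the same lower bound on the Newton
polyhedron of `A`. -/
theorem le_of_mem_newtonPolyhedron {n : ℕ} {A : Finset (Fin n →₀ ℕ)} {ρ : Fin n → ℝ} {c : ℝ}
    (hρ : ∀ i, 0 ≤ ρ i) (hA : ∀ a ∈ A, c ≤ ∑ i, ρ i * (a i : ℝ)) {y : Fin n → ℝ}
    (hy : y ∈ newtonPolyhedron n A) : c ≤ ∑ i, ρ i * y i := by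
  obtain ⟨u, hu, r, hr, rfl⟩ := hy
  have hconv : Convex ℝ {x : Fin n → ℝ | c ≤ Fintype.linearCombination ℝ ρ x} :=
    convex_halfSpace_ge (LinearMap.isLinear _) c
  have hu' : c ≤ ∑ i, ρ i * u i := by
    have : u ∈ {x : Fin n → ℝ | c ≤ Fintype.linearCombination ℝ ρ x} := by
      refine convexHull_min ?_ hconv hu
      rintro _ ⟨a, ha, rfl⟩
      simpa [Fintype.linearCombination_apply, mul_comm] using hA a ha
    simpa [Fintype.linearCombination_apply, mul_comm] using this
  have hr' : 0 ≤ ∑ i, ρ i * r i := Finset.sum_nonneg fun i _ => mul_nonneg (hρ i) (hr i)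
  simp only [Pi.add_apply, mul_add, Finset.sum_add_distrib]
  linarith

theorem mem_newtonPolyhedron_of_mem {n : ℕ} {A : Finset (Fin n →₀ ℕ)} {a : Fin n →₀ ℕ}
    (ha : a ∈ A) : (fun i : Fin n => (a i : ℝ)) ∈ newtonPolyhedron n A :=
  ⟨_, subset_convexHull ℝ _ ⟨a, ha, rfl⟩, 0, fun _ => le_rfl, add_zero _⟩

/-- A point of `A` at which a strictly positive functional is minimal lies on the Newton
diagram. -/
theorem mem_newtonDiagram_of_forall_le {n : ℕ} {A : Finset (Fin n →₀ ℕ)} {ρ : Fin n → ℝ}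
    (hρ : ∀ i, 0 < ρ i) {a : Fin n →₀ ℕ} (ha : a ∈ A)
    (hmin : ∀ b ∈ A, ∑ i, ρ i * (a i : ℝ) ≤ ∑ i, ρ i * (b i : ℝ)) :
    (fun i : Fin n => (a i : ℝ)) ∈ newtonDiagram n A :=
  ⟨mem_newtonPolyhedron_of_mem ha, ρ, hρ, fun _ hy =>
    le_of_mem_newtonPolyhedron (fun i => (hρ i).le) hmin hy⟩

/-- A functional vanishing on `n` linearly independent vectors of `ℝⁿ` is zero. -/
theorem eq_zero_of_forall_sum_mul_eq_zero {n : ℕ} {ι : Type*} [Fintype ι] {v : ι → Fin n → ℝ}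
    (hv : LinearIndependent ℝ v) (hcard : Fintype.card ι = n) {ρ : Fin n → ℝ}
    (h : ∀ j, ∑ i, ρ i * v j i = 0) : ρ = 0 := by
  have hspan : Submodule.span ℝ (Set.range v) = ⊤ :=
    hv.span_eq_top_of_card_eq_finrank' (by simpa using hcard)
  have hle : Submodule.span ℝ (Set.range v) ≤
      LinearMap.ker (Fintype.linearCombination ℝ ρ) := by
    rw [Submodule.span_le]
    rintro _ ⟨j, rfl⟩
    simpa [Fintype.linearCombination_apply, mul_comm] using h j
  have hmem : ρ ∈ LinearMap.ker (Fintype.linearCombination ℝ ρ) :=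
    hle (hspan ▸ Submodule.mem_top)
  have hsq : ρ ⬝ᵥ ρ = 0 := by
    simpa [Fintype.linearCombination_apply, dotProduct] using hmem
  exact dotProduct_self_eq_zero.mp hsq

/-- A functional supporting an essential subset of a set of variety `{0}` is strictly positive. -/
theorem pos_of_supports_linearIndependent {n : ℕ} {A B : Finset (Fin n →₀ ℕ)} (hn : 1 ≤ n)
    (hA : hasVarietyZero n A) (hcard : B.card = n)
    (hlin : LinearIndependent ℝ (fun b : B => fun i : Fin n => ((b : Fin n →₀ ℕ) i : ℝ)))
    {ρ : Fin n → ℝ} (hρ : ∀ i, 0 ≤ ρ i) (hρ0 : ρ ≠ 0) {c : ℝ}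
    (hB : ∀ b ∈ B, ∑ i, ρ i * (b i : ℝ) = c) (hc : ∀ a ∈ A, c ≤ ∑ i, ρ i * (a i : ℝ)) :
    ∀ i, 0 < ρ i := by
  obtain ⟨b, hb⟩ : B.Nonempty := Finset.card_pos.mp (by omega)
  have hc0 : c ≠ 0 := by
    rintro rfl
    exact hρ0 (eq_zero_of_forall_sum_mul_eq_zero hlin (by simpa using hcard) fun j => hB j j.2)
  have hcpos : 0 < c := lt_of_le_of_ne
    (hB b hb ▸ Finset.sum_nonneg fun i _ => mul_nonneg (hρ i) (Nat.cast_nonneg _)) hc0.symm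
  intro i
  obtain ⟨k, -, hk⟩ := hA.2 i
  have hi : c ≤ ρ i * k := by
    have := hc _ hk
    rwa [Finset.sum_eq_single i (fun j _ hj => by simp [Finsupp.single_eq_of_ne hj])
      (by simp), Finsupp.single_eq_same] at this
  exact pos_of_mul_pos_left (hcpos.trans_le hi) (Nat.cast_nonneg k)

theorem essential_of_newtonDiagram_eq {n : ℕ} {A A' B : Finset (Fin n →₀ ℕ)} (hn : 1 ≤ n)
    (hA : hasVarietyZero n A)
    (hΓ : {a : Fin n →₀ ℕ | a ∈ A ∧ (fun i : Fin n => (a i : ℝ)) ∈ newtonDiagram n A} =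
          {a : Fin n →₀ ℕ | a ∈ A' ∧ (fun i : Fin n => (a i : ℝ)) ∈ newtonDiagram n A'})
    (h : essential n A B) : essential n A' B := by
  obtain ⟨hBA, hcard, hlin, ρ, hρ, hρ0, c, hB, hc⟩ := h
  have hpos := pos_of_supports_linearIndependent hn hA hcard hlin hρ hρ0 hB hc
  refine ⟨fun b hb => ?_, hcard, hlin, ρ, hρ, hρ0, c, hB, fun a ha => ?_⟩
  · exact (hΓ.subset ⟨hBA hb, mem_newtonDiagram_of_forall_le hpos (hBA hb)
      fun a ha => (hB b hb).trans_le (hc a ha)⟩).1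
  · obtain ⟨m, hm, hmin⟩ := A'.exists_min_image (fun a => ∑ i, ρ i * (a i : ℝ)) ⟨a, ha⟩
    exact (hc m (hΓ.superset ⟨hm, mem_newtonDiagram_of_forall_le hpos hm hmin⟩).1).trans
      (hmin a ha)

/-- if `A ∩ Γ(A) = A' ∩ Γ(A')` then `A` and `A'` have the same essential
subsets, and hence the same intersection ideal `⋂_B (X₁^{α₁^B},…,Xₙ^{αₙ^B})`. -/
theorem stmt17 (n : ℕ) (hn : 1 ≤ n) (A A' : Finset (Fin n →₀ ℕ))
    (hA : hasVarietyZero n A) (hA' : hasVarietyZero n A')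
    (hΓ : {a : Fin n →₀ ℕ | a ∈ A ∧ (fun i : Fin n => (a i : ℝ)) ∈ newtonDiagram n A} =
          {a : Fin n →₀ ℕ | a ∈ A' ∧ (fun i : Fin n => (a i : ℝ)) ∈ newtonDiagram n A'}) :
    (∀ B : Finset (Fin n →₀ ℕ), essential n A B ↔ essential n A' B) ∧
    (⨅ B ∈ {B : Finset (Fin n →₀ ℕ) | essential n A B},
        Ideal.span (Set.range fun i : Fin n =>
          (X i : MvPolynomial (Fin n) ℂ) ^ ((∑ a ∈ B, a) i))) =
      (⨅ B ∈ {B : Finset (Fin n →₀ ℕ) | essential n A' B},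
        Ideal.span (Set.range fun i : Fin n =>
          (X i : MvPolynomial (Fin n) ℂ) ^ ((∑ a ∈ B, a) i))) := by
  have h : ∀ B : Finset (Fin n →₀ ℕ), essential n A B ↔ essential n A' B := fun B =>
    ⟨essential_of_newtonDiagram_eq hn hA hΓ, essential_of_newtonDiagram_eq hn hA' hΓ.symm⟩
  exact ⟨h, by simp only [Set.mem_ofPred_eq, h]⟩
end
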